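/- arXiv:1403.0691 — 2 statements merged into one kernel-verified Lean document; each statement's English description precedes it below -/
import Mathlib

section
/- For each (n+1)-cycle π ∈ C_{n+1}, define F(π) = p : {1,…,n} → {1,…,n} by p(i) = π^{n+1−i}(1) − 1. Then F is a bijection from C_{n+1} onto S_n, and for every π ∈ C_{n+1} and every ℓ ∈ {1,…,n}, Exc(π) = {1,…,ℓ} if and only if DesBot(F(π)) = {1,…,ℓ−1} (the empty set when ℓ = 1). -/
/-- The excedance set `Exc(π) = {i ∈ {1,…,m-1} : π(i) > i}` of `π ∈ S_m`, as a set of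
1-indexed positions. -/
def excSet {m : ℕ} (π : Equiv.Perm (Fin m)) : Finset ℕ :=
  (Finset.univ.filter (fun i : Fin m => i < π i)).image (fun i : Fin m => (i : ℕ) + 1)

/-- The descent bottoms set `DesBot(π) = {π(i) : 2 ≤ i ≤ m, π(i) < π(i-1)}` of `π ∈ S_m`,
as a set of 1-indexed values. -/
def desBotSet {m : ℕ} (π : Equiv.Perm (Fin m)) : Finset ℕ :=
  (Finset.univ.filter (fun i : Fin m =>
      0 < (i : ℕ) ∧ π i < π ⟨(i : ℕ) - 1, lt_of_le_of_lt (Nat.sub_le _ _) i.isLt⟩)).image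
    (fun i : Fin m => (π i : ℕ) + 1)

open Equiv Equiv.Perm in
theorem pow_apply_zero_injOn {n : ℕ} {π : Perm (Fin (n + 1))} (hc : π.IsCycle)
    (hs : π.support.card = n + 1) {a b : ℕ} (ha : a ≤ n) (hb : b ≤ n)
    (h : (π ^ a) 0 = (π ^ b) 0) : a = b := by
  have hsupp : π.support = Finset.univ := Finset.eq_univ_of_card _ (by simpa using hs)
  have h0 : π 0 ≠ 0 := Perm.mem_support.1 (hsupp ▸ Finset.mem_univ 0)
  have hpow : π ^ a = π ^ b := hc.pow_eq_pow_iff.2 ⟨0, h0, h⟩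
  have hord : orderOf π = n + 1 := hc.orderOf.trans hs
  exact pow_injOn_Iio_orderOf (by simp [hord]; omega) (by simp [hord]; omega) hpow

open Equiv Equiv.Perm in
/-- A full cycle of `Fin (n + 1)`, read as the word `π^n(0) - 1, …, π(0) - 1`. -/
noncomputable def cycleWord {n : ℕ}
    (π : {π : Perm (Fin (n + 1)) // π.IsCycle ∧ π.support.card = n + 1}) : Perm (Fin n) :=
  Equiv.ofBijective
    (fun i => ((π.1 ^ (n - (i : ℕ))) 0).pred fun h => by
      have := pow_apply_zero_injOn π.2.1 π.2.2 (a := n - i) (b := 0) (by omega) (by omega)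
        (by simpa using h)
      omega)
    (Finite.injective_iff_bijective.1 fun i j h => by
      have := pow_apply_zero_injOn π.2.1 π.2.2 (a := n - i) (b := n - j) (by omega) (by omega)
        (Fin.pred_inj.1 h)
      omega)

open Equiv Equiv.Perm in
theorem succ_cycleWord {n : ℕ}
    (π : {π : Perm (Fin (n + 1)) // π.IsCycle ∧ π.support.card = n + 1}) (i : Fin n) :
    (cycleWord π i).succ = (π.1 ^ (n - (i : ℕ))) 0 := by
  simp [cycleWord]

open Equiv Equiv.Perm in
theorem exists_pow_apply_zero {n : ℕ} {π : Perm (Fin (n + 1))} (hc : π.IsCycle)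
    (hs : π.support.card = n + 1) (x : Fin (n + 1)) : ∃ k ≤ n, (π ^ k) 0 = x := by
  have hinj : Function.Injective fun k : Fin (n + 1) => (π ^ (k : ℕ)) 0 := fun a b h =>
    Fin.ext (pow_apply_zero_injOn hc hs (by omega) (by omega) h)
  obtain ⟨k, hk⟩ := Finite.injective_iff_surjective.1 hinj x
  exact ⟨k, by omega, hk⟩

open Equiv Equiv.Perm in
theorem pow_succ_apply_zero {n : ℕ} {π : Perm (Fin (n + 1))} (hc : π.IsCycle)
    (hs : π.support.card = n + 1) : (π ^ (n + 1)) 0 = 0 := by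
  have h : π ^ (n + 1) = 1 := orderOf_dvd_iff_pow_eq_one.1 (hc.orderOf.trans hs).dvd
  rw [h, one_apply]

open Equiv Equiv.Perm in
theorem cycleWord_injective {n : ℕ} : Function.Injective (cycleWord (n := n)) := by
  intro π σ h
  have key : ∀ k ≤ n, (π.1 ^ k) 0 = (σ.1 ^ k) 0 := by
    intro k hk
    rcases Nat.eq_zero_or_pos k with rfl | hpos
    · simp
    · have h1 := succ_cycleWord π ⟨n - k, by omega⟩
      have h2 := succ_cycleWord σ ⟨n - k, by omega⟩
      simp only [Nat.sub_sub_self hk] at h1 h2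
      rw [← h1, ← h2, h]
  apply Subtype.ext
  ext1 x
  obtain ⟨k, hk, rfl⟩ := exists_pow_apply_zero π.2.1 π.2.2 x
  have hstep : (π.1 ^ (k + 1)) 0 = (σ.1 ^ (k + 1)) 0 := by
    rcases hk.lt_or_eq with hlt | rfl
    · exact key _ hlt
    · rw [pow_succ_apply_zero π.2.1 π.2.2, pow_succ_apply_zero σ.2.1 σ.2.2]
  rw [pow_succ', pow_succ', mul_apply, mul_apply] at hstep
  rw [hstep, key k hk]

theorem finRotate_pow_apply_zero {n k : ℕ} (hk : k ≤ n) :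
    (finRotate (n + 1) ^ k) 0 = ⟨k, by omega⟩ := by
  induction k with
  | zero => rfl
  | succ k ih =>
    rw [pow_succ', Equiv.Perm.mul_apply, ih (by omega), finRotate_of_lt (by omega)]

open Equiv Equiv.Perm in
theorem cycleWord_surjective {n : ℕ} (hn : 0 < n) : Function.Surjective (cycleWord (n := n)) := by
  intro p
  set g : Perm (Fin (n + 1)) := Perm.decomposeFin.symm (0, Fin.revPerm.trans p) with hg
  have hg0 : g 0 = 0 := by simp [hg]
  have hgs (k : Fin n) : g k.succ = (p k.rev).succ := by simp [hg]
  have hrot : (finRotate (n + 1)).IsCycle ∧ (finRotate (n + 1)).support.card = n + 1 := by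
    obtain ⟨m, rfl⟩ : ∃ m, n = m + 1 := ⟨n - 1, by omega⟩
    exact ⟨isCycle_finRotate, by simp [support_finRotate]⟩
  refine ⟨⟨g * finRotate (n + 1) * g⁻¹, hrot.1.conj, ?_⟩, ?_⟩
  · rw [card_support_conj, hrot.2]
  · ext1 i
    apply Fin.succ_injective
    have hg0' : g⁻¹ 0 = 0 := by rw [inv_eq_iff_eq, hg0]
    rw [succ_cycleWord, conj_pow, mul_apply, mul_apply, hg0',
      finRotate_pow_apply_zero (Nat.sub_le _ _)]
    have hi : (⟨n - i, by omega⟩ : Fin (n + 1)) = i.rev.succ := by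
      ext; simp [Fin.val_rev]; omega
    rw [hi, hgs, Fin.rev_rev]

open Equiv Equiv.Perm in
theorem excSet_eq_insert_desBotSet_cycleWord {n : ℕ} (hn : 0 < n)
    (π : {π : Perm (Fin (n + 1)) // π.IsCycle ∧ π.support.card = n + 1}) :
    excSet π.1 = insert 1 ((desBotSet (cycleWord π)).image (· + 1)) := by
  have hw := succ_cycleWord π
  have hstep : ∀ i : Fin n, (hi : 0 < (i : ℕ)) →
      π.1 (cycleWord π i).succ = (cycleWord π ⟨i - 1, by omega⟩).succ := by
    intro i hi
    rw [hw, hw, ← mul_apply, ← pow_succ']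
    congr 2
    simp only
    omega
  have h0 : (0 : Fin (n + 1)) < π.1 0 := by
    refine Fin.pos_of_ne_zero fun h => ?_
    have := pow_apply_zero_injOn π.2.1 π.2.2 (a := 1) (b := 0) hn (by omega) (by simpa using h)
    omega
  ext x
  simp only [excSet, desBotSet, Finset.mem_image, Finset.mem_filter, Finset.mem_univ, true_and,
    Finset.mem_insert]
  constructor
  · rintro ⟨j, hj, rfl⟩
    induction j using Fin.cases with
    | zero => simp
    | succ v =>
      right
      obtain ⟨i, rfl⟩ := (cycleWord π).surjective v
      have hi : 0 < (i : ℕ) := by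
        rw [Nat.pos_iff_ne_zero]
        intro hi
        rw [hw, ← mul_apply, ← pow_succ', hi, Nat.sub_zero,
          pow_succ_apply_zero π.2.1 π.2.2] at hj
        exact absurd hj (Fin.not_lt_zero _)
      rw [hstep i hi, Fin.succ_lt_succ_iff] at hj
      exact ⟨_, ⟨i, ⟨hi, hj⟩, rfl⟩, by simp⟩
  · rintro (rfl | ⟨_, ⟨i, ⟨hi, hd⟩, rfl⟩, rfl⟩)
    · exact ⟨0, h0, by simp⟩
    · refine ⟨(cycleWord π i).succ, ?_, by simp⟩
      rw [hstep i hi, Fin.succ_lt_succ_iff]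
      exact hd

theorem insert_one_image_succ_eq_Icc_iff {s : Finset ℕ} (hs : 0 ∉ s) {l : ℕ} (hl : 1 ≤ l) :
    insert 1 (s.image (· + 1)) = Finset.Icc 1 l ↔ s = Finset.Icc 1 (l - 1) := by
  simp only [Finset.ext_iff, Finset.mem_insert, Finset.mem_image, Finset.mem_Icc]
  constructor
  · intro h a
    have ha := h (a + 1)
    simp only [Nat.add_right_cancel_iff, exists_eq_right] at ha
    rcases Nat.eq_zero_or_pos a with rfl | hpos
    · simpa using hs
    · have h1 : a + 1 ≠ 1 := by omega
      rw [← or_iff_right h1 (b := a ∈ s), ha]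
      omega
  · intro h a
    simp only [h]
    constructor
    · rintro (rfl | ⟨b, hb, rfl⟩) <;> omega
    · intro ha
      by_cases h1 : a = 1
      · exact Or.inl h1
      · exact Or.inr ⟨a - 1, by omega, by omega⟩

theorem stmt14 (n : ℕ) (hn : 0 < n) :
    ∃ F : {π : Equiv.Perm (Fin (n + 1)) // π.IsCycle ∧ π.support.card = n + 1} →
          Equiv.Perm (Fin n),
      Function.Bijective F ∧
      -- Defining formula (1-indexed): `F(π)(i) = π^{n+1-i}(1) - 1`.  With positions and
      -- values 0-indexed this reads `(F π)(i) + 1 = π^{n-i}(0)` (as natural numbers).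
      (∀ π : {π : Equiv.Perm (Fin (n + 1)) // π.IsCycle ∧ π.support.card = n + 1},
        ∀ i : Fin n, ((F π) i : ℕ) + 1 = (((π : Equiv.Perm (Fin (n + 1))) ^ (n - (i : ℕ))) 0 : ℕ)) ∧
      (∀ π : {π : Equiv.Perm (Fin (n + 1)) // π.IsCycle ∧ π.support.card = n + 1},
        ∀ ℓ : ℕ, 1 ≤ ℓ → ℓ ≤ n →
          (excSet (π : Equiv.Perm (Fin (n + 1))) = Finset.Icc 1 ℓ ↔
            desBotSet (F π) = Finset.Icc 1 (ℓ - 1))) := by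
  refine ⟨cycleWord, ⟨cycleWord_injective, cycleWord_surjective hn⟩, fun π i => ?_,
    fun π l hl _ => ?_⟩
  · rw [← succ_cycleWord π i, Fin.val_succ]
  · rw [excSet_eq_insert_desBotSet_cycleWord hn π]
    exact insert_one_image_succ_eq_Icc_iff (by simp [desBotSet]) hl
end

section
/- There exists a constant C > 0 such that for every even positive integer n, | [b^{n/2 − 1} a^{n/2}] · (2·log 2)^n / n! − 1/(2·log 2·√(1 − log 2)) | ≤ C/√n. -/
/-- `[b^r a^s]` where `r + s = n - 1`: the number of permutations `π ∈ S_n` (on `Fin n`,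
position `i : Fin n` representing the 1-indexed position `i + 1`) such that for every
`i ∈ {1, …, n-1}`, `π(i) > i` if and only if `i ≤ r`. -/
noncomputable def excWordCount (n r : ℕ) : ℕ :=
  Nat.card {π : Equiv.Perm (Fin n) //
    ∀ i : Fin n, (i : ℕ) + 1 ≤ n - 1 → ((i : ℕ) + 1 ≤ r ↔ i < π i)}

/-- The number of permutations of `Fin n` that send row `j` to a column `> j + k` for `j < r`, to a
column `≤ j + k` for `r ≤ j < t`, and are unconstrained on the remaining rows. -/
noncomputable def boardCount (n r t k : ℕ) : ℕ :=
  Nat.card {π : Equiv.Perm (Fin n) // ∀ j : Fin n,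
    ((j : ℕ) < r → (j : ℕ) + k < π j) ∧ (r ≤ j → (j : ℕ) < t → (π j : ℕ) ≤ j + k)}

/-- The constraints of `boardCount n r t k` imposed on rows `1, …, n` of an `(n + 1)`-board,
with columns shifted by one. -/
def ShiftedBoard (n r t k : ℕ) (π : Equiv.Perm (Fin (n + 1))) : Prop :=
  ∀ j : Fin n, ((j : ℕ) < r → (j : ℕ) + 1 + k < π j.succ) ∧
    (r ≤ j → (j : ℕ) < t → (π j.succ : ℕ) ≤ j + 1 + k)

theorem card_fin_le {n k : ℕ} (hk : k ≤ n) :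
    Nat.card {p : Fin (n + 1) // (p : ℕ) ≤ k} = k + 1 := by
  have e : {p : Fin (n + 1) // (p : ℕ) ≤ k} ≃ Fin (k + 1) :=
    { toFun := fun p => ⟨p.1, by have := p.2; omega⟩
      invFun := fun p => ⟨⟨p, by omega⟩, by have := p.2; simp; omega⟩
      left_inv := fun p => by simp
      right_inv := fun p => by simp }
  rw [Nat.card_congr e, Nat.card_fin]

theorem card_shiftedBoard_and_le {n r t k : ℕ} (hk : k ≤ n) :
    Nat.card {π : Equiv.Perm (Fin (n + 1)) // (π 0 : ℕ) ≤ k ∧ ShiftedBoard n r t k π} =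
      (k + 1) * boardCount n r t k := by
  rw [← card_fin_le hk, boardCount, ← Nat.card_prod]
  refine (Nat.card_congr (Equiv.trans (Equiv.subtypeEquiv
    Equiv.Perm.decomposeFin.symm ?_) (Equiv.refl _))).symm.trans
      (Nat.card_congr Equiv.subtypeProdEquivProd)
  rintro ⟨p, σ⟩
  simp only [ShiftedBoard, Equiv.Perm.decomposeFin_symm_apply_zero,
    Equiv.Perm.decomposeFin_symm_apply_succ]
  refine and_congr_right fun hp => forall_congr' fun j => ?_
  by_cases h : (σ j).succ = p
  · have h' : (σ j : ℕ) + 1 = p := by rw [← h]; simp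
    rw [h, Equiv.swap_apply_right]
    simp only [Fin.val_zero]
    omega
  · rw [Equiv.swap_apply_of_ne_of_ne (Fin.succ_ne_zero _) h]
    simp only [Fin.val_succ]
    omega

theorem card_shiftedBoard {n r t k : ℕ} (hr : r ≤ t) (ht : t ≤ n) :
    Nat.card {π : Equiv.Perm (Fin (n + 1)) // ShiftedBoard n r t k π} =
      boardCount (n + 1) r t (k + 1) := by
  refine Nat.card_congr (Equiv.subtypeEquiv (Equiv.mulRight (finRotate (n + 1))) fun π => ?_)
  simp only [ShiftedBoard, Equiv.coe_mulRight, Equiv.Perm.coe_mul, Function.comp_apply]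
  rw [Fin.forall_fin_succ']
  simp only [finRotate_apply, Fin.val_castSucc, Fin.coeSucc_eq_succ, Fin.val_last]
  constructor
  · intro h
    refine ⟨fun j => ?_, by omega, by omega⟩
    have := h j
    omega
  · rintro ⟨h, -⟩ j
    have := h j
    omega

theorem boardCount_succ_of_zero {n t k : ℕ} (hk : k ≤ n) :
    boardCount (n + 1) 0 (t + 1) k = (k + 1) * boardCount n 0 t k := by
  rw [← card_shiftedBoard_and_le hk]
  refine Nat.card_congr (Equiv.subtypeEquivRight fun π => ?_)
  rw [Fin.forall_fin_succ]
  simp [ShiftedBoard]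

theorem boardCount_succ_add {n r t k : ℕ} (hk : k ≤ n) (hr : r ≤ t) (ht : t ≤ n) :
    boardCount (n + 1) (r + 1) (t + 1) k + (k + 1) * boardCount n r t k =
      boardCount (n + 1) r t (k + 1) := by
  classical
  rw [← card_shiftedBoard hr ht, ← card_shiftedBoard_and_le hk, boardCount]
  simp only [Nat.card_eq_fintype_card, Fintype.card_subtype]
  rw [← Finset.card_union_of_disjoint]
  · congr 1
    ext π
    simp only [Finset.mem_union, Finset.mem_filter, Finset.mem_univ, true_and]
    rw [Fin.forall_fin_succ]
    simp only [ShiftedBoard, Fin.val_zero, Fin.val_succ, Nat.add_lt_add_iff_right,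
      Nat.add_le_add_iff_right]
    by_cases h : (π 0 : ℕ) ≤ k
    · simp [h]
    · simp [h]
      omega
  · rw [Finset.disjoint_filter]
    intro π _ h1 h2
    have := (h1 0).1 (by simp)
    simp at this
    omega

/-- The operator `g ↦ x · (g (x + 1) - g x)`. -/
def mulFwdDiff : (ℕ → ℤ) →ₗ[ℤ] (ℕ → ℤ) where
  toFun g x := x * (g (x + 1) - g x)
  map_add' f g := by ext x; simp; ring
  map_smul' c g := by ext x; simp; ring

theorem mulFwdDiff_apply (g : ℕ → ℤ) (x : ℕ) : mulFwdDiff g x = x * (g (x + 1) - g x) := rfl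

theorem boardCount_free (n k : ℕ) : boardCount n 0 0 k = n.factorial := by
  simp [boardCount, Nat.card_eq_fintype_card, Fintype.card_perm]

theorem boardCount_eq (t : ℕ) : ∀ r k : ℕ, r ≤ t →
    (boardCount (t + k) r t k : ℤ) =
      k.factorial * (mulFwdDiff ^ r) (fun x => (x : ℤ) ^ (t - r)) (k + 1) := by
  induction t with
  | zero =>
    intro r k hr
    obtain rfl : r = 0 := by omega
    simp [boardCount_free]
  | succ t ih =>
    intro r k hr
    rcases r with _ | r
    · have h := ih 0 k (Nat.zero_le _)
      rw [show t + 1 + k = t + k + 1 by omega, boardCount_succ_of_zero (by omega)]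
      simp only [pow_zero, Module.End.one_apply, Nat.sub_zero] at h ⊢
      push_cast at h ⊢
      rw [h]
      ring
    · have h1 := ih r k (by omega)
      have h2 := ih r (k + 1) (by omega)
      have h3 := boardCount_succ_add (n := t + k) (r := r) (t := t) (k := k) (by omega) (by omega)
        (by omega)
      rw [show t + 1 + k = t + k + 1 by omega, pow_succ', Module.End.mul_apply, mulFwdDiff_apply,
        Nat.add_sub_add_right]
      rw [show t + (k + 1) = t + k + 1 by omega] at h2
      have h4 : (boardCount (t + k + 1) (r + 1) (t + 1) k : ℤ) +
          (k + 1) * boardCount (t + k) r t k =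
        boardCount (t + k + 1) r t (k + 1) := by exact_mod_cast h3
      rw [h1, h2] at h4
      rw [eq_sub_of_add_eq h4, Nat.factorial_succ]
      push_cast
      ring

theorem excWordCount_eq_boardCount {n r : ℕ} (hr : r ≤ n - 1) :
    excWordCount n r = boardCount n r n 0 := by
  refine Nat.card_congr (Equiv.subtypeEquivRight fun π => forall_congr' fun j => ?_)
  have h1 := j.2
  have h2 := (π j).2
  rw [Fin.lt_def]
  omega

/-- `surjCoeff m j = j! · S(m + 1, j + 1)`, with `S` the Stirling numbers of the second kind. -/
def surjCoeff : ℕ → ℕ → ℕ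
  | 0, 0 => 1
  | 0, _ + 1 => 0
  | m + 1, 0 => surjCoeff m 0
  | m + 1, j + 1 => (j + 2) * surjCoeff m (j + 1) + (j + 1) * surjCoeff m j

theorem surjCoeff_eq_zero : ∀ {m j : ℕ}, m < j → surjCoeff m j = 0
  | 0, _ + 1, _ => rfl
  | m + 1, j + 1, h => by
    rw [surjCoeff, surjCoeff_eq_zero (by omega), surjCoeff_eq_zero (by omega), mul_zero, mul_zero,
      add_zero]

theorem sum_surjCoeff_succ {R : Type*} [CommRing R] (m : ℕ) (f : ℕ → R) :
    ∑ j ∈ Finset.range (m + 2), (surjCoeff (m + 1) j : R) * f j =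
      ∑ j ∈ Finset.range (m + 1), (surjCoeff m j : R) * ((j + 1) * (f j + f (j + 1))) := by
  have h1 : ∑ j ∈ Finset.range (m + 1), (surjCoeff m j : R) * ((j + 1) * f j) =
      ∑ j ∈ Finset.range (m + 2), (surjCoeff m j : R) * ((j + 1) * f j) := by
    rw [Finset.sum_range_succ _ (m + 1), surjCoeff_eq_zero (Nat.lt_succ_self m)]
    simp
  have h2 : ∑ j ∈ Finset.range (m + 1), (surjCoeff m j : R) * ((j + 1) * (f j + f (j + 1))) =
      ∑ j ∈ Finset.range (m + 2), (surjCoeff m j : R) * ((j + 1) * f j) +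
      ∑ j ∈ Finset.range (m + 1), (surjCoeff m j : R) * ((j + 1) * f (j + 1)) := by
    rw [← h1, ← Finset.sum_add_distrib]
    exact Finset.sum_congr rfl fun j _ => by ring
  rw [h2, Finset.sum_range_succ' _ (m + 1), Finset.sum_range_succ' _ (m + 1), add_right_comm,
    ← Finset.sum_add_distrib]
  congr 1
  · refine Finset.sum_congr rfl fun j _ => ?_
    rw [surjCoeff]
    push_cast
    ring
  · simp [surjCoeff]

theorem mul_choose_succ (x j : ℕ) :
    x * x.choose j = (j + 1) * x.choose (j + 1) + j * x.choose j := by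
  have h := Nat.choose_succ_right_eq x j
  rcases le_or_gt j x with hj | hj
  · obtain ⟨d, rfl⟩ := Nat.exists_eq_add_of_le hj
    rw [Nat.add_sub_cancel_left] at h
    linarith
  · simp [Nat.choose_eq_zero_of_lt hj, Nat.choose_eq_zero_of_lt (Nat.lt_succ_of_lt hj)]

theorem pow_succ_eq_sum_choose (s x : ℕ) :
    (x : ℤ) ^ (s + 1) =
      ∑ j ∈ Finset.range (s + 1), (surjCoeff s j : ℤ) * ((j + 1) * x.choose (j + 1)) := by
  induction s with
  | zero => simp [surjCoeff]
  | succ s ih =>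
    rw [sum_surjCoeff_succ, pow_succ, ih, Finset.sum_mul]
    refine Finset.sum_congr rfl fun j _ => ?_
    have h : (x * x.choose (j + 1) : ℤ) =
      (j + 2) * x.choose (j + 2) + (j + 1) * x.choose (j + 1) := by
        exact_mod_cast mul_choose_succ x (j + 1)
    push_cast
    linear_combination (surjCoeff s j : ℤ) * (j + 1) * h

theorem mulFwdDiff_pow_choose (r : ℕ) : ∀ i : ℕ,
    (mulFwdDiff ^ r) (fun x => (x.choose (i + 1) : ℤ)) 1 = surjCoeff r i := by
  induction r with
  | zero =>
    rintro (_ | i)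
    · simp [surjCoeff]
    · simp [surjCoeff, Nat.choose_eq_zero_of_lt]
  | succ r ih =>
    intro i
    have h : mulFwdDiff (fun x => (x.choose (i + 1) : ℤ)) =
        ((i : ℤ) + 1) • (fun x : ℕ => (x.choose (i + 1) : ℤ)) +
          (i : ℤ) • (fun x : ℕ => (x.choose i : ℤ)) := by
      ext x
      rw [mulFwdDiff_apply, Nat.choose_succ_succ]
      have := mul_choose_succ x i
      simp only [Pi.add_apply, Pi.smul_apply, smul_eq_mul]
      push_cast
      rw [add_sub_cancel_right]
      exact_mod_cast this
    rw [pow_succ, Module.End.mul_apply, h, map_add, map_smul, map_smul, Pi.add_apply, Pi.smul_apply,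
      Pi.smul_apply, ih]
    rcases i with _ | i
    · simp [surjCoeff]
    · rw [ih, surjCoeff]
      push_cast
      simp only [smul_eq_mul]
      ring

theorem excWordCount_eq_sum (r s : ℕ) :
    (excWordCount (r + s + 1) r : ℤ) =
      ∑ j ∈ Finset.range (s + 1), (surjCoeff s j : ℤ) * ((j + 1) * surjCoeff r j) := by
  have h := boardCount_eq (r + s + 1) r 0 (by omega)
  rw [excWordCount_eq_boardCount (by omega), ← Nat.add_zero (r + s + 1)]
  simp only [Nat.add_zero] at h ⊢
  rw [h, show r + s + 1 - r = s + 1 by omega]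
  have hf : (fun x : ℕ => (x : ℤ) ^ (s + 1)) = ∑ j ∈ Finset.range (s + 1),
      ((surjCoeff s j : ℤ) * (j + 1)) • (fun x : ℕ => (x.choose (j + 1) : ℤ)) := by
    ext x
    rw [pow_succ_eq_sum_choose, Finset.sum_apply]
    exact Finset.sum_congr rfl fun j _ => by simp [mul_assoc]
  rw [hf, map_sum, Finset.sum_apply, Nat.factorial_zero, Nat.cast_one, one_mul]
  refine Finset.sum_congr rfl fun j _ => ?_
  rw [map_smul, Pi.smul_apply, zero_add, mulFwdDiff_pow_choose, smul_eq_mul, mul_assoc]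

theorem two_mul_excWordCount (p : ℕ) :
    2 * excWordCount (2 * p + 2) p = ∑ j ∈ Finset.range (p + 2), surjCoeff (p + 1) j ^ 2 := by
  zify
  rw [show 2 * p + 2 = p + (p + 1) + 1 by ring, excWordCount_eq_sum]
  set y : ℕ → ℤ := fun j => (j + 1) * surjCoeff p j with hy
  have hlast : y (p + 1) = 0 := by simp [hy, surjCoeff_eq_zero]
  have h0 : (surjCoeff (p + 1) 0 : ℤ) = y 0 := by simp [hy, surjCoeff]
  have hs (j : ℕ) : (surjCoeff (p + 1) (j + 1) : ℤ) = y (j + 1) + y j := by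
    simp only [hy, surjCoeff]
    push_cast
    ring
  have hsum : ∑ j ∈ Finset.range (p + 1), y (j + 1) ^ 2 + y 0 ^ 2 =
      ∑ j ∈ Finset.range (p + 1), y j ^ 2 := by
    rw [← Finset.sum_range_succ' (fun j => y j ^ 2), Finset.sum_range_succ, hlast]
    simp
  rw [Finset.sum_range_succ' _ (p + 1), Finset.sum_range_succ' _ (p + 1), h0]
  simp only [hs]
  rw [show ((0 : ℕ) : ℤ) + 1 = 1 by simp]
  have e1 : ∑ j ∈ Finset.range (p + 1),
      (y (j + 1) + y j) * (((j + 1 : ℕ) + 1) * surjCoeff p (j + 1)) =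
      ∑ j ∈ Finset.range (p + 1), y (j + 1) ^ 2 + ∑ j ∈ Finset.range (p + 1), y j * y (j + 1) := by
    rw [← Finset.sum_add_distrib]
    exact Finset.sum_congr rfl fun j _ => by simp only [hy]; ring
  have e2 : ∑ j ∈ Finset.range (p + 1), (y (j + 1) + y j) ^ 2 =
      ∑ j ∈ Finset.range (p + 1), y (j + 1) ^ 2 +
        2 * ∑ j ∈ Finset.range (p + 1), y j * y (j + 1) + ∑ j ∈ Finset.range (p + 1), y j ^ 2 := by
    rw [Finset.mul_sum, ← Finset.sum_add_distrib, ← Finset.sum_add_distrib]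
    exact Finset.sum_congr rfl fun j _ => by ring
  have e3 : y 0 = surjCoeff p 0 := by simp [hy]
  rw [e1, e2, ← hsum, ← e3]
  ring

theorem iteratedDeriv_inv_exp_sub_one (m : ℕ) : ∀ z : ℂ, Complex.exp z ≠ 1 →
    iteratedDeriv m (fun z => (Complex.exp z - 1)⁻¹) z =
      (-1) ^ m * ∑ j ∈ Finset.range (m + 1),
        (surjCoeff m j : ℂ) * ((Complex.exp z - 1)⁻¹) ^ (j + 1) := by
  induction m with
  | zero => intro z _; simp [surjCoeff]
  | succ m ih =>
    intro z hz
    have hopen : IsOpen {z : ℂ | Complex.exp z ≠ 1} :=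
      isOpen_ne_fun Complex.continuous_exp continuous_const
    have hz' : Complex.exp z - 1 ≠ 0 := sub_ne_zero.mpr hz
    have hev : iteratedDeriv m (fun z => (Complex.exp z - 1)⁻¹) =ᶠ[nhds z] fun z => (-1) ^ m *
        ∑ j ∈ Finset.range (m + 1), (surjCoeff m j : ℂ) * ((Complex.exp z - 1)⁻¹) ^ (j + 1) := by
      filter_upwards [hopen.mem_nhds hz] with y hy using ih y hy
    rw [iteratedDeriv_succ, hev.deriv_eq]
    have hw : HasDerivAt (fun z => (Complex.exp z - 1)⁻¹)
        (-((Complex.exp z - 1)⁻¹ + ((Complex.exp z - 1)⁻¹) ^ 2)) z := by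
      refine (((Complex.hasDerivAt_exp z).sub_const 1).fun_inv hz').congr_deriv ?_
      field_simp
      ring
    have hsum := (HasDerivAt.fun_sum (u := Finset.range (m + 1)) fun j _ =>
      ((hw.fun_pow (j + 1)).const_mul (surjCoeff m j : ℂ))).const_mul ((-1 : ℂ) ^ m)
    rw [hsum.deriv, sum_surjCoeff_succ, pow_succ (-1 : ℂ) m, mul_assoc,
      Finset.mul_sum (a := (-1 : ℂ))]
    congr 1
    refine Finset.sum_congr rfl fun j _ => ?_
    simp only [Nat.add_sub_cancel]
    push_cast
    ring

theorem exists_extension_inv_exp_sub_one : ∃ F : ℂ → ℂ,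
    DifferentiableOn ℂ F {z | |z.im| < 3} ∧
      ∀ z : ℂ, |z.im| < 3 → z ≠ 0 → Complex.exp z ≠ 1 ∧ F z = (Complex.exp z - 1)⁻¹ - z⁻¹ := by
  set φ : ℂ → ℂ := dslope (fun z => Complex.exp z - 1) 0 with hφ
  set χ : ℂ → ℂ := dslope φ 0 with hχ
  have hφd : Differentiable ℂ φ := by
    rw [← differentiableOn_univ, hφ, Complex.differentiableOn_dslope Filter.univ_mem]
    exact (Complex.differentiable_exp.sub_const 1).differentiableOn
  have hχd : Differentiable ℂ χ := by
    rw [← differentiableOn_univ, hχ, Complex.differentiableOn_dslope Filter.univ_mem]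
    exact hφd.differentiableOn
  have hφ0 : φ 0 = 1 := by
    rw [hφ, dslope_same, deriv_sub_const]
    simp
  have hφz (z : ℂ) : z * φ z = Complex.exp z - 1 := by
    have := sub_smul_dslope (fun z => Complex.exp z - 1) 0 z
    simpa using this
  have hχz (z : ℂ) : z * χ z = φ z - 1 := by
    have := sub_smul_dslope φ 0 z
    simpa [hφ0] using this
  have hexp (z : ℂ) (hz : |z.im| < 3) (h0 : z ≠ 0) : Complex.exp z ≠ 1 := by
    intro h
    obtain ⟨k, hk⟩ := Complex.exp_eq_one_iff.mp h
    have him : z.im = k * (2 * Real.pi) := by rw [hk]; simp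
    have hk0 : k ≠ 0 := by rintro rfl; simp at hk; exact h0 hk
    have h1 : (1 : ℝ) ≤ |(k : ℝ)| := by exact_mod_cast Int.one_le_abs hk0
    rw [him, abs_mul, abs_of_pos (by positivity : 0 < 2 * Real.pi)] at hz
    nlinarith [Real.pi_gt_three]
  have hφne (z : ℂ) (hz : |z.im| < 3) : φ z ≠ 0 := by
    intro h
    by_cases h0 : z = 0
    · rw [h0, hφ0] at h; exact one_ne_zero h
    · have := hφz z
      rw [h, mul_zero] at this
      exact hexp z hz h0 (sub_eq_zero.mp this.symm)
  refine ⟨fun z => -χ z / φ z, ?_, fun z hz h0 => ⟨hexp z hz h0, ?_⟩⟩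
  · exact hχd.neg.differentiableOn.fun_div hφd.differentiableOn fun z hz => hφne z hz
  · have h1 := hφne z hz
    rw [← hφz, mul_inv]
    field_simp
    linear_combination -hχz z

theorem norm_inv_exp_sub_one_le {z : ℂ} (hz : 2 ≤ |z.re|) : ‖(Complex.exp z - 1)⁻¹‖ ≤ 2 := by
  have h : 1 / 2 ≤ ‖Complex.exp z - 1‖ := by
    rcases le_abs'.mp hz with h | h
    · have h1 : Real.exp z.re ≤ 1 / 2 := by
        rw [show (1 / 2 : ℝ) = (2 : ℝ)⁻¹ by norm_num]
        rw [show z.re = -(-z.re) by ring, Real.exp_neg]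
        exact inv_anti₀ (by norm_num) (by linarith [Real.add_one_le_exp (-z.re)])
      have := norm_sub_norm_le (1 : ℂ) (Complex.exp z)
      rw [Complex.norm_exp, norm_one, norm_sub_rev] at this
      linarith
    · have := norm_sub_norm_le (Complex.exp z) 1
      rw [Complex.norm_exp, norm_one] at this
      linarith [Real.add_one_le_exp z.re]
  rw [norm_inv]
  exact (inv_anti₀ (by norm_num) h).trans (by norm_num)

theorem exists_norm_sum_surjCoeff_sub_le : ∃ M : ℝ, 0 ≤ M ∧ ∀ (m : ℕ) (z : ℂ),
    |z.im| ≤ Real.pi / 2 → z ≠ 0 →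
      ‖∑ j ∈ Finset.range (m + 1), (surjCoeff m j : ℂ) * ((Complex.exp z - 1)⁻¹) ^ (j + 1) -
        m.factorial * (z⁻¹) ^ (m + 1)‖ ≤ m.factorial * M := by
  obtain ⟨F, hFd, hF⟩ := exists_extension_inv_exp_sub_one
  have hopen : IsOpen {z : ℂ | |z.im| < 3} :=
    isOpen_lt (continuous_abs.comp Complex.continuous_im) continuous_const
  set K : Set ℂ := Set.Icc (-2 : ℝ) 2 ×ℂ Set.Icc (-(13 / 5) : ℝ) (13 / 5)
  have hK : IsCompact K := isCompact_Icc.reProdIm isCompact_Icc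
  have hKs : K ⊆ {z : ℂ | |z.im| < 3} := by
    intro z hz
    have := hz.2
    simp only [Set.mem_preimage, Set.mem_Icc] at this
    simp only [Set.mem_ofPred_eq, abs_lt]
    constructor <;> linarith
  obtain ⟨M₀, hM₀⟩ := hK.exists_bound_of_continuousOn (hFd.continuousOn.mono hKs)
  have hbound (z : ℂ) (hz : |z.im| ≤ 13 / 5) : ‖F z‖ ≤ max M₀ 3 := by
    rcases le_total |z.re| 2 with h | h
    · refine (hM₀ z ⟨?_, ?_⟩).trans (le_max_left _ _)
      · exact abs_le.mp h
      · exact abs_le.mp hz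
    · have h0 : z ≠ 0 := by rintro rfl; simp at h; linarith
      rw [(hF z (by linarith) h0).2]
      refine (norm_sub_le _ _).trans (le_trans ?_ (le_max_right _ _))
      have h1 : ‖z⁻¹‖ ≤ 1 := by
        rw [norm_inv]
        exact inv_le_one_of_one_le₀ (by linarith [Complex.abs_re_le_norm z])
      linarith [norm_inv_exp_sub_one_le h]
  refine ⟨max M₀ 3, le_trans (by norm_num) (le_max_right _ _), fun m z hz h0 => ?_⟩
  have hz3 : |z.im| < 3 := by linarith [Real.pi_lt_d2]
  have hball : ∀ y ∈ Metric.closedBall z 1, |y.im| ≤ 13 / 5 := by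
    intro y hy
    rw [Metric.mem_closedBall, Complex.dist_eq] at hy
    have h1 := (Complex.abs_im_le_norm (y - z)).trans hy
    rw [Complex.sub_im] at h1
    have h2 := abs_add_le (y.im - z.im) z.im
    rw [sub_add_cancel] at h2
    linarith [Real.pi_lt_d2]
  have hcauchy : ‖iteratedDeriv m F z‖ ≤ m.factorial * max M₀ 3 := by
    have hd : DiffContOnCl ℂ F (Metric.ball z 1) := by
      apply DifferentiableOn.diffContOnCl
      rw [closure_ball z one_ne_zero]
      exact hFd.mono fun y hy => lt_of_le_of_lt (hball y hy) (by norm_num)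
    have := Complex.norm_iteratedDeriv_le_of_forall_mem_sphere_norm_le m one_pos hd
      (C := max M₀ 3) fun y hy => hbound y (hball y (Metric.sphere_subset_closedBall hy))
    simpa using this
  have hev : (fun z => (Complex.exp z - 1)⁻¹) =ᶠ[nhds z] F + Inv.inv := by
    filter_upwards [hopen.mem_nhds hz3, isOpen_ne.mem_nhds h0] with y hy hy0
    rw [Pi.add_apply, (hF y hy hy0).2]
    ring
  have hadd := hev.iteratedDeriv_eq m
  rw [iteratedDeriv_add ((hFd.contDiffOn hopen).contDiffAt (hopen.mem_nhds hz3))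
    (contDiffAt_inv ℂ h0), iteratedDeriv_inv_exp_sub_one m z (hF z hz3 h0).1,
    iteratedDeriv_eq_iterate (f := Inv.inv), iter_deriv_inv] at hadd
  have hpow : z ^ (-1 - (m : ℤ)) = (z⁻¹) ^ (m + 1) := by
    rw [show (-1 - (m : ℤ)) = -((m + 1 : ℕ) : ℤ) by push_cast; ring, zpow_neg, zpow_natCast,
      inv_pow]
  rw [hpow] at hadd
  rw [show ∑ j ∈ Finset.range (m + 1), (surjCoeff m j : ℂ) * ((Complex.exp z - 1)⁻¹) ^ (j + 1) -
      m.factorial * (z⁻¹) ^ (m + 1) = (-1) ^ m * iteratedDeriv m F z by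
    have h1 : ((-1 : ℂ) ^ m) * (-1) ^ m = 1 := by rw [← mul_pow]; simp
    linear_combination (-1 : ℂ) ^ m * hadd + (m.factorial * (z⁻¹) ^ (m + 1) -
      ∑ j ∈ Finset.range (m + 1), (surjCoeff m j : ℂ) * ((Complex.exp z - 1)⁻¹) ^ (j + 1)) * h1]
  simpa using hcauchy

theorem integral_cos_two_mul_int (d : ℤ) :
    ∫ t in (-(Real.pi / 2))..(Real.pi / 2), Real.cos (2 * d * t) =
      if d = 0 then Real.pi else 0 := by
  split_ifs with h
  · simp [h]
  · have hd : (2 * d : ℝ) ≠ 0 := by simpa using h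
    rw [intervalIntegral.integral_comp_mul_left _ hd, integral_cos,
      show 2 * (d : ℝ) * (Real.pi / 2) = d * Real.pi by ring,
      show 2 * (d : ℝ) * (-(Real.pi / 2)) = -(d * Real.pi) by ring, Real.sin_neg,
      Real.sin_int_mul_pi]
    simp

theorem normSq_sum_exp (n : ℕ) (c : ℕ → ℝ) (t : ℝ) :
    ‖∑ j ∈ Finset.range n, (c j : ℂ) * Complex.exp (-(2 * t * Complex.I)) ^ (j + 1)‖ ^ 2 =
      ∑ i ∈ Finset.range n, ∑ j ∈ Finset.range n,
        c i * c j * Real.cos (2 * ((i - j : ℤ) : ℝ) * t) := by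
  have hexp (j : ℕ) : Complex.exp (-(2 * t * Complex.I)) ^ (j + 1) =
      Complex.exp (((-(2 * (j + 1) * t) : ℝ) : ℂ) * Complex.I) := by
    rw [← Complex.exp_nat_mul]
    congr 1
    push_cast
    ring
  simp only [hexp]
  rw [Complex.sq_norm, Complex.normSq_apply, Complex.re_sum, Complex.im_sum]
  simp only [Complex.re_ofReal_mul, Complex.im_ofReal_mul, Complex.exp_ofReal_mul_I_re,
    Complex.exp_ofReal_mul_I_im, Finset.sum_mul_sum]
  rw [← Finset.sum_add_distrib]
  refine Finset.sum_congr rfl fun i _ => ?_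
  rw [← Finset.sum_add_distrib]
  refine Finset.sum_congr rfl fun j _ => ?_
  rw [show 2 * ((i - j : ℤ) : ℝ) * t = -(2 * (j + 1) * t) - -(2 * (i + 1) * t) by push_cast; ring,
    Real.cos_sub]
  ring

theorem integral_normSq_sum_exp (n : ℕ) (c : ℕ → ℝ) :
    ∫ t in (-(Real.pi / 2))..(Real.pi / 2),
      ‖∑ j ∈ Finset.range n, (c j : ℂ) * Complex.exp (-(2 * t * Complex.I)) ^ (j + 1)‖ ^ 2 =
      Real.pi * ∑ j ∈ Finset.range n, c j ^ 2 := by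
  simp only [normSq_sum_exp]
  rw [intervalIntegral.integral_finsetSum fun i _ => by
    apply Continuous.intervalIntegrable; fun_prop, Finset.mul_sum]
  refine Finset.sum_congr rfl fun i hi => ?_
  rw [intervalIntegral.integral_finsetSum fun j _ => by
    apply Continuous.intervalIntegrable; fun_prop]
  simp only [intervalIntegral.integral_const_mul, integral_cos_two_mul_int, sub_eq_zero,
    Nat.cast_inj, mul_ite, mul_zero]
  rw [Finset.sum_ite_eq, if_pos hi]
  ring

theorem excWordCount_eq_integral (p : ℕ) :
    (excWordCount (2 * p + 2) p : ℝ) = (2 * Real.pi)⁻¹ *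
      ∫ t in (-(Real.pi / 2))..(Real.pi / 2), ‖∑ j ∈ Finset.range (p + 2),
        (surjCoeff (p + 1) j : ℂ) * Complex.exp (-(2 * t * Complex.I)) ^ (j + 1)‖ ^ 2 := by
  have h := integral_normSq_sum_exp (p + 2) (fun j => (surjCoeff (p + 1) j : ℝ))
  have h2 : (2 * excWordCount (2 * p + 2) p : ℝ) =
    ∑ j ∈ Finset.range (p + 2), (surjCoeff (p + 1) j : ℝ) ^ 2 := by
      exact_mod_cast two_mul_excWordCount p
  simp only [Complex.ofReal_natCast] at h
  rw [h, ← h2]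
  field_simp

/-- The point of the curve `exp z = 1 + exp (2 * t * I)` with imaginary part `t`. -/
noncomputable def polePoint (t : ℝ) : ℂ := Real.log (2 * Real.cos t) + t * Complex.I

theorem polePoint_im (t : ℝ) : (polePoint t).im = t := by simp [polePoint]

theorem normSq_polePoint (t : ℝ) :
    ‖polePoint t‖ ^ 2 = Real.log (2 * Real.cos t) ^ 2 + t ^ 2 := by
  rw [Complex.sq_norm, Complex.normSq_apply, polePoint_im]
  simp [polePoint]
  ring

theorem inv_exp_polePoint_sub_one {t : ℝ} (ht : t ∈ Set.Ioo (-(Real.pi / 2)) (Real.pi / 2)) :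
    (Complex.exp (polePoint t) - 1)⁻¹ = Complex.exp (-(2 * t * Complex.I)) := by
  have hc : 0 < Real.cos t := Real.cos_pos_of_mem_Ioo ht
  rw [Complex.exp_neg]
  congr 1
  rw [polePoint, Complex.exp_add, ← Complex.ofReal_exp, Real.exp_log (by positivity)]
  push_cast
  rw [Complex.two_cos, add_mul, ← Complex.exp_add, ← Complex.exp_add]
  rw [show (-(t : ℂ) * Complex.I + t * Complex.I) = 0 by ring, Complex.exp_zero,
    add_sub_cancel_right]
  congr 1
  ring

theorem one_sub_inv_sub_sq_half_le_log_cos {t : ℝ} (ht : |t| ≤ 7 / 10) :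
    -(t ^ 2 / 2) / (1 - t ^ 2 / 2) ≤ Real.log (Real.cos t) := by
  have h2 : t ^ 2 ≤ 49 / 100 := by
    rw [← sq_abs]; nlinarith [abs_nonneg t]
  have hv : 0 < 1 - t ^ 2 / 2 := by linarith
  have hc : 1 - t ^ 2 / 2 ≤ Real.cos t := Real.one_sub_sq_div_two_le_cos
  have h1 := Real.one_sub_inv_le_log_of_pos (hv.trans_le hc)
  have h3 := inv_anti₀ hv hc
  have h4 : -(t ^ 2 / 2) / (1 - t ^ 2 / 2) = 1 - (1 - t ^ 2 / 2)⁻¹ := by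
    rw [div_eq_iff hv.ne', sub_mul, inv_mul_cancel₀ hv.ne']
    ring
  rw [h4]
  linarith

theorem log_two_mul_cos {t : ℝ} (ht : t ∈ Set.Ioo (-(Real.pi / 2)) (Real.pi / 2)) :
    Real.log (2 * Real.cos t) = Real.log 2 + Real.log (Real.cos t) :=
  Real.log_mul two_ne_zero (Real.cos_pos_of_mem_Ioo ht).ne'

theorem log_two_sq_mul_le_normSq_polePoint {t : ℝ}
    (ht : t ∈ Set.Ioo (-(Real.pi / 2)) (Real.pi / 2)) :
    Real.log 2 ^ 2 * (1 + t ^ 2 / 100) ≤ ‖polePoint t‖ ^ 2 := by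
  have hL1 := Real.log_two_lt_d9
  have hL2 := Real.log_two_gt_d9
  rw [normSq_polePoint]
  have hLsq : Real.log 2 ^ 2 ≤ 481 / 1000 := by nlinarith
  rcases le_total |t| (7 / 10) with h | h
  · have h2 : t ^ 2 ≤ 49 / 100 := by
      rw [← sq_abs]; nlinarith [abs_nonneg t]
    have hl := one_sub_inv_sub_sq_half_le_log_cos h
    have hl2 : -(t ^ 2 * (100 / 151)) ≤ -(t ^ 2 / 2) / (1 - t ^ 2 / 2) := by
      rw [le_div_iff₀ (by linarith)]
      nlinarith [sq_nonneg t]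
    rw [log_two_mul_cos ht]
    have : Real.log 2 * -(t ^ 2 * (100 / 151)) ≤ Real.log 2 * Real.log (Real.cos t) :=
      mul_le_mul_of_nonneg_left (hl2.trans hl) (by linarith)
    nlinarith [sq_nonneg t, sq_nonneg (Real.log (Real.cos t))]
  · have h2 : 49 / 100 ≤ t ^ 2 := by
      rw [← sq_abs]; nlinarith [abs_nonneg t]
    nlinarith [sq_nonneg (Real.log (2 * Real.cos t))]

theorem abs_normSq_polePoint_sub_le {t : ℝ} (ht : |t| ≤ 1 / 2) :
    |‖polePoint t‖ ^ 2 - (Real.log 2 ^ 2 + (1 - Real.log 2) * t ^ 2)| ≤ 2 * t ^ 4 := by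
  have hL1 := Real.log_two_lt_d9
  have hL2 := Real.log_two_gt_d9
  have hmem : t ∈ Set.Ioo (-(Real.pi / 2)) (Real.pi / 2) := by
    have := abs_le.mp ht
    constructor <;> linarith [Real.pi_gt_three]
  have h2 : t ^ 2 ≤ 1 / 4 := by
    rw [← sq_abs]; nlinarith [abs_nonneg t]
  have h0 := sq_nonneg t
  have hcos : Real.cos t ≤ 1 - t ^ 2 / 2 + t ^ 4 * (5 / 96) := by
    have := (abs_le.mp (Real.cos_bound (x := t) (by linarith))).2
    rw [show |t| ^ 4 = t ^ 4 from (by decide : Even 4).pow_abs t] at this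
    linarith
  have hup : Real.log (Real.cos t) ≤ -(t ^ 2 / 2) + t ^ 4 / 2 := by
    have := Real.log_le_sub_one_of_pos (Real.cos_pos_of_mem_Ioo hmem)
    nlinarith [sq_nonneg (t ^ 2)]
  have hlow : -(t ^ 2 / 2) - t ^ 4 / 2 ≤ Real.log (Real.cos t) := by
    refine le_trans ?_ (one_sub_inv_sub_sq_half_le_log_cos (by linarith))
    rw [le_div_iff₀ (by linarith)]
    nlinarith [sq_nonneg (t ^ 2), mul_nonneg (sq_nonneg (t ^ 2)) h0]
  have hnonpos : Real.log (Real.cos t) ≤ 0 := Real.log_nonpos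
    (Real.cos_pos_of_mem_Ioo hmem).le (Real.cos_le_one t)
  have hsq : Real.log (Real.cos t) ^ 2 ≤ t ^ 4 := by
    have : -t ^ 2 ≤ Real.log (Real.cos t) := by nlinarith
    nlinarith
  rw [normSq_polePoint, log_two_mul_cos hmem]
  have h4 : 0 ≤ t ^ 4 := by positivity
  have e : (Real.log 2 + Real.log (Real.cos t)) ^ 2 + t ^ 2 -
      (Real.log 2 ^ 2 + (1 - Real.log 2) * t ^ 2) =
      2 * Real.log 2 * (Real.log (Real.cos t) + t ^ 2 / 2) + Real.log (Real.cos t) ^ 2 := by ring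
  rw [e, abs_le]
  constructor <;> nlinarith [sq_nonneg (Real.log (Real.cos t))]

/-- The ratio `(log 2)² / ‖polePoint t‖²` on `(-π/2, π/2)`, extended by zero. -/
noncomputable def poleRatio : ℝ → ℝ :=
  (Set.Ioo (-(Real.pi / 2)) (Real.pi / 2)).indicator fun t => Real.log 2 ^ 2 / ‖polePoint t‖ ^ 2

theorem poleRatio_nonneg (t : ℝ) : 0 ≤ poleRatio t :=
  Set.indicator_nonneg (fun _ _ => by positivity) t

theorem log_two_le_norm_polePoint {t : ℝ} (ht : t ∈ Set.Ioo (-(Real.pi / 2)) (Real.pi / 2)) :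
    Real.log 2 ≤ ‖polePoint t‖ := by
  refine le_of_sq_le_sq ?_ (norm_nonneg _)
  exact le_trans (by nlinarith [sq_nonneg t, sq_nonneg (Real.log 2 * t)])
    (log_two_sq_mul_le_normSq_polePoint ht)

theorem inv_one_add_two_mul_le_exp_neg {x : ℝ} (h0 : 0 ≤ x) (h1 : x ≤ 1 / 2) :
    (1 + 2 * x)⁻¹ ≤ Real.exp (-x) := by
  refine le_trans ?_ (Real.add_one_le_exp (-x))
  rw [inv_le_iff_one_le_mul₀ (by linarith)]
  nlinarith

theorem poleRatio_le_exp (t : ℝ) : poleRatio t ≤ Real.exp (-(1 / 200) * t ^ 2) := by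
  rw [poleRatio, Set.indicator_apply]
  split_ifs with ht
  · have hL : 0 < Real.log 2 := Real.log_pos one_lt_two
    have h2 : t ^ 2 ≤ 4 := by
      have := Real.pi_lt_d2
      nlinarith [ht.1, ht.2]
    have hx := inv_one_add_two_mul_le_exp_neg (x := t ^ 2 / 200) (by positivity) (by linarith)
    refine le_trans ?_ (hx.trans_eq (by ring_nf))
    refine (div_le_div_of_nonneg_left (by positivity) (by positivity)
      (log_two_sq_mul_le_normSq_polePoint ht)).trans_eq ?_
    field_simp
    ring
  · positivity

theorem abs_inv_one_add_sub_exp_neg_le {x : ℝ} (hx : 0 ≤ x) :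
    |(1 + x)⁻¹ - Real.exp (-x)| ≤ x ^ 2 := by
  have h1 : Real.exp (-x) ≤ (1 + x)⁻¹ := by
    rw [Real.exp_neg]
    exact inv_anti₀ (by linarith) (by linarith [Real.add_one_le_exp x])
  rw [abs_of_nonneg (by linarith)]
  have h2 : (1 + x)⁻¹ ≤ 1 - x + x ^ 2 := by
    rw [inv_le_iff_one_le_mul₀ (by linarith)]
    nlinarith [pow_nonneg hx 3]
  linarith [Real.add_one_le_exp (-x)]

/-- Half the second derivative at `0` of `‖polePoint t‖² / (log 2)²`. -/
noncomputable def poleCurvature : ℝ := (1 - Real.log 2) / Real.log 2 ^ 2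

theorem poleCurvature_mem : 1 / 200 ≤ poleCurvature ∧ poleCurvature ≤ 1 := by
  have hL1 := Real.log_two_lt_d9
  have hL2 := Real.log_two_gt_d9
  rw [poleCurvature, le_div_iff₀ (by positivity), div_le_one (by positivity)]
  constructor <;> nlinarith

theorem abs_poleRatio_sub_exp_le (t : ℝ) :
    |poleRatio t - Real.exp (-poleCurvature * t ^ 2)| ≤ 16 * t ^ 4 := by
  obtain ⟨hκ0, hκ1⟩ := poleCurvature_mem
  rcases le_total |t| (1 / 2) with h | h
  · have hL1 := Real.log_two_lt_d9
    have hL2 := Real.log_two_gt_d9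
    have hmem : t ∈ Set.Ioo (-(Real.pi / 2)) (Real.pi / 2) := by
      have := abs_le.mp h
      constructor <;> linarith [Real.pi_gt_three]
    rw [poleRatio, Set.indicator_of_mem hmem]
    have hΦ := abs_normSq_polePoint_sub_le h
    have hlow : Real.log 2 ^ 2 ≤ ‖polePoint t‖ ^ 2 :=
      pow_le_pow_left₀ (by linarith) (log_two_le_norm_polePoint hmem) 2
    have hLsq : 48 / 100 ≤ Real.log 2 ^ 2 := by nlinarith
    have hx : 0 ≤ poleCurvature * t ^ 2 := by positivity
    have hκ : Real.log 2 ^ 2 * (1 + poleCurvature * t ^ 2) =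
        Real.log 2 ^ 2 + (1 - Real.log 2) * t ^ 2 := by
      rw [poleCurvature]; field_simp
    rw [← hκ, abs_sub_comm] at hΦ
    have hpos : 0 < ‖polePoint t‖ ^ 2 := by linarith
    have e1 : |Real.log 2 ^ 2 / ‖polePoint t‖ ^ 2 - (1 + poleCurvature * t ^ 2)⁻¹| ≤ 5 * t ^ 4 := by
      have e : Real.log 2 ^ 2 / ‖polePoint t‖ ^ 2 - (1 + poleCurvature * t ^ 2)⁻¹ =
          (Real.log 2 ^ 2 * (1 + poleCurvature * t ^ 2) - ‖polePoint t‖ ^ 2) /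
            (‖polePoint t‖ ^ 2 * (1 + poleCurvature * t ^ 2)) := by
        rw [inv_eq_one_div, div_sub_div _ _ hpos.ne' (by positivity), mul_one]
      rw [e, abs_div, abs_of_pos (a := ‖polePoint t‖ ^ 2 * _) (by positivity),
        div_le_iff₀ (by positivity)]
      have h1 : 48 / 100 ≤ ‖polePoint t‖ ^ 2 * (1 + poleCurvature * t ^ 2) := by
        nlinarith [mul_nonneg hpos.le hx]
      have h4 : 0 ≤ t ^ 4 := by positivity
      nlinarith
    have e2 := abs_inv_one_add_sub_exp_neg_le hx
    have e3 : (poleCurvature * t ^ 2) ^ 2 ≤ t ^ 4 := by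
      have : poleCurvature ^ 2 ≤ 1 := pow_le_one₀ (by linarith) hκ1
      nlinarith [sq_nonneg (t ^ 2)]
    have h4 : 0 ≤ t ^ 4 := by positivity
    rw [neg_mul]
    refine (abs_sub_le _ _ _).trans ((add_le_add e1 (e2.trans e3)).trans ?_)
    linarith
  · have h4 : 1 ≤ 16 * t ^ 4 := by
      have : (1 / 2 : ℝ) ^ 4 ≤ |t| ^ 4 := pow_le_pow_left₀ (by norm_num) h 4
      rw [show |t| ^ 4 = t ^ 4 from (by decide : Even 4).pow_abs t] at this
      linarith
    refine le_trans ?_ h4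
    have h1 : poleRatio t ≤ 1 := (poleRatio_le_exp t).trans
      (Real.exp_le_one_iff.mpr (by nlinarith [sq_nonneg t]))
    have h2 : Real.exp (-poleCurvature * t ^ 2) ≤ 1 :=
      Real.exp_le_one_iff.mpr (by nlinarith [sq_nonneg t])
    rw [abs_le]
    constructor <;> linarith [poleRatio_nonneg t, Real.exp_pos (-poleCurvature * t ^ 2)]

theorem measurable_poleRatio : Measurable poleRatio := by
  refine Measurable.indicator ?_ measurableSet_Ioo
  simp only [normSq_polePoint]
  fun_prop

theorem integrable_poleRatio_pow (m : ℕ) :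
    MeasureTheory.Integrable fun t => poleRatio t ^ (m + 1) := by
  refine (integrable_exp_neg_mul_sq (b := (m + 1 : ℕ) * (1 / 200)) (by positivity)).mono'
    (measurable_poleRatio.pow_const _).aestronglyMeasurable
    (Filter.Eventually.of_forall fun t => ?_)
  rw [Real.norm_of_nonneg (pow_nonneg (poleRatio_nonneg t) _)]
  refine (pow_le_pow_left₀ (poleRatio_nonneg t) (poleRatio_le_exp t) _).trans_eq ?_
  rw [← Real.exp_nat_mul]
  ring_nf

theorem abs_poleRatio_pow_sub_le (m : ℕ) (t : ℝ) :
    |poleRatio t ^ (m + 1) - Real.exp (-((m + 1) * poleCurvature) * t ^ 2)| ≤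
      16 * (m + 1) * (t ^ 4 * Real.exp (-(m * (1 / 200)) * t ^ 2)) := by
  have h1 : Real.exp (-((m + 1) * poleCurvature) * t ^ 2) =
      Real.exp (-poleCurvature * t ^ 2) ^ (m + 1) := by
    rw [← Real.exp_nat_mul]
    push_cast
    ring_nf
  have h2 : max |poleRatio t| |Real.exp (-poleCurvature * t ^ 2)| ≤
      Real.exp (-(1 / 200) * t ^ 2) := by
    rw [abs_of_nonneg (poleRatio_nonneg t), Real.abs_exp]
    refine max_le (poleRatio_le_exp t) (Real.exp_le_exp.mpr ?_)
    nlinarith [sq_nonneg t, poleCurvature_mem.1]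
  have h3 : Real.exp (-(m * (1 / 200)) * t ^ 2) = Real.exp (-(1 / 200) * t ^ 2) ^ m := by
    rw [← Real.exp_nat_mul]
    ring_nf
  rw [h1, h3]
  refine (abs_pow_sub_pow_le _ _ _).trans ?_
  rw [Nat.add_sub_cancel]
  calc _ ≤ 16 * t ^ 4 * ((m + 1 : ℕ) : ℝ) * Real.exp (-(1 / 200) * t ^ 2) ^ m := by
        gcongr
        exact abs_poleRatio_sub_exp_le t
    _ = _ := by push_cast; ring

theorem integrable_pow_four_mul_exp {b : ℝ} (hb : 0 < b) :
    MeasureTheory.Integrable fun t : ℝ => t ^ 4 * Real.exp (-b * t ^ 2) := by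
  have := integrable_rpow_mul_exp_neg_mul_sq hb (s := 4) (by norm_num)
  refine this.congr (Filter.Eventually.of_forall fun t => ?_)
  simp only
  norm_cast

theorem integral_pow_four_mul_exp_mul {m : ℕ} (hm : 0 < m) (b : ℝ) :
    ∫ t : ℝ, t ^ 4 * Real.exp (-(m * b) * t ^ 2) =
      (∫ t : ℝ, t ^ 4 * Real.exp (-b * t ^ 2)) / (m ^ 2 * √m) := by
  have hm' : (0 : ℝ) < m := by exact_mod_cast hm
  have h := MeasureTheory.Measure.integral_comp_mul_left
    (fun t : ℝ => t ^ 4 * Real.exp (-b * t ^ 2)) √m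
  have h4 : √(m : ℝ) ^ 4 = m ^ 2 := by
    rw [show 4 = 2 * 2 by norm_num, pow_mul, Real.sq_sqrt hm'.le]
  have h5 (t : ℝ) : (√m * t) ^ 4 * Real.exp (-b * (√m * t) ^ 2) =
      m ^ 2 * (t ^ 4 * Real.exp (-(m * b) * t ^ 2)) := by
    rw [mul_pow, mul_pow, h4, Real.sq_sqrt hm'.le]
    ring_nf
  simp only [h5] at h
  rw [MeasureTheory.integral_const_mul, abs_of_pos (by positivity), smul_eq_mul] at h
  rw [eq_div_iff (by positivity)]
  calc _ = (m ^ 2 * ∫ t : ℝ, t ^ 4 * Real.exp (-(m * b) * t ^ 2)) * √m := by ring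
    _ = _ := by rw [h, mul_right_comm, inv_mul_cancel₀ (by positivity), one_mul]

theorem exists_abs_integral_poleRatio_pow_sub_le : ∃ C : ℝ, 0 ≤ C ∧ ∀ m : ℕ, 0 < m →
    |(∫ t, poleRatio t ^ (m + 1)) - √(Real.pi / ((m + 1) * poleCurvature))| ≤ C / (m * √m) := by
  set K : ℝ := ∫ t : ℝ, t ^ 4 * Real.exp (-(1 / 200) * t ^ 2) with hK
  have hK0 : 0 ≤ K := MeasureTheory.integral_nonneg fun t => by positivity
  refine ⟨32 * K, by positivity, fun m hm => ?_⟩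
  have hm' : (1 : ℝ) ≤ m := by exact_mod_cast hm
  have hκ : 0 < poleCurvature := lt_of_lt_of_le (by norm_num) poleCurvature_mem.1
  have hdiff : (∫ t, poleRatio t ^ (m + 1)) - √(Real.pi / ((m + 1) * poleCurvature)) =
      ∫ t, (poleRatio t ^ (m + 1) - Real.exp (-((m + 1) * poleCurvature) * t ^ 2)) := by
    rw [MeasureTheory.integral_sub (integrable_poleRatio_pow m)
      (integrable_exp_neg_mul_sq (by positivity)), integral_gaussian]
  rw [hdiff, ← Real.norm_eq_abs]
  refine (MeasureTheory.norm_integral_le_of_norm_le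
    ((integrable_pow_four_mul_exp (b := m * (1 / 200)) (by positivity)).const_mul
      (16 * (m + 1 : ℝ)))
    (Filter.Eventually.of_forall fun t => abs_poleRatio_pow_sub_le m t)).trans ?_
  rw [MeasureTheory.integral_const_mul, integral_pow_four_mul_exp_mul hm, ← hK, ← mul_div_assoc,
    div_le_div_iff₀ (by positivity) (by positivity)]
  have : (0 : ℝ) ≤ K * (m * √m) * m * 16 := by positivity
  nlinarith

theorem exists_abs_excWordCount_sub_integral_le : ∃ C : ℝ, 0 ≤ C ∧ ∀ p : ℕ,
    |(excWordCount (2 * p + 2) p : ℝ) * Real.log 2 ^ (2 * (p + 1)) / ((p + 1).factorial : ℝ) ^ 2 -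
      (2 * Real.pi * Real.log 2 ^ 2)⁻¹ * ∫ t, poleRatio t ^ (p + 2)| ≤
        C * Real.log 2 ^ (p + 1) := by
  obtain ⟨M, hM0, hM⟩ := exists_norm_sum_surjCoeff_sub_le
  have hL : 0 < Real.log 2 := Real.log_pos one_lt_two
  have hL1 : Real.log 2 ≤ 1 := by linarith [Real.log_two_lt_d9]
  refine ⟨(M ^ 2 + 2 * M / Real.log 2) / 2, by positivity, fun p => ?_⟩
  set m := p + 1 with hm
  set S : ℝ → ℂ := fun t => ∑ j ∈ Finset.range (m + 1),
    (surjCoeff m j : ℂ) * Complex.exp (-(2 * t * Complex.I)) ^ (j + 1) with hS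
  have hScont : Continuous S := by fun_prop
  set I := Set.Ioo (-(Real.pi / 2)) (Real.pi / 2) with hI
  have hf : (0 : ℝ) < m.factorial := by exact_mod_cast Nat.factorial_pos m
  have hcount : (excWordCount (2 * p + 2) p : ℝ) * Real.log 2 ^ (2 * m) / (m.factorial : ℝ) ^ 2 =
      (2 * Real.pi)⁻¹ * ∫ t in I, Real.log 2 ^ (2 * m) / (m.factorial : ℝ) ^ 2 * ‖S t‖ ^ 2 := by
    rw [excWordCount_eq_integral, intervalIntegral.integral_of_le (by linarith [Real.pi_pos]),
      MeasureTheory.integral_Ioc_eq_integral_Ioo, MeasureTheory.integral_const_mul]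
    ring
  have hratio : (2 * Real.pi * Real.log 2 ^ 2)⁻¹ * ∫ t, poleRatio t ^ (p + 2) =
      (2 * Real.pi)⁻¹ * ∫ t in I, (Real.log 2 ^ 2)⁻¹ * poleRatio t ^ (m + 1) := by
    rw [MeasureTheory.integral_const_mul,
      MeasureTheory.setIntegral_eq_integral_of_forall_compl_eq_zero, mul_inv,
      mul_assoc]
    intro t ht
    rw [poleRatio, Set.indicator_of_notMem ht]
    simp
  have hpoint : ∀ t ∈ I, ‖Real.log 2 ^ (2 * m) / (m.factorial : ℝ) ^ 2 * ‖S t‖ ^ 2 -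
      (Real.log 2 ^ 2)⁻¹ * poleRatio t ^ (m + 1)‖ ≤
        (M ^ 2 + 2 * M / Real.log 2) * Real.log 2 ^ m := by
    intro t ht
    have hz := log_two_le_norm_polePoint ht
    set z := polePoint t with hzdef
    have hz0 : 0 < ‖z‖ := hL.trans_le hz
    have h1 := hM m z (by rw [polePoint_im]; exact abs_le.mpr ⟨ht.1.le, ht.2.le⟩)
      (norm_pos_iff.mp hz0)
    rw [inv_exp_polePoint_sub_one ht] at h1
    change ‖S t - _‖ ≤ _ at h1
    set x := ‖S t‖ / m.factorial with hx
    set y := (‖z‖⁻¹) ^ (m + 1) with hy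
    have hxy : |x - y| ≤ M := by
      have h2 := (abs_norm_sub_norm_le (S t) (m.factorial * (z⁻¹) ^ (m + 1))).trans h1
      rw [norm_mul, norm_pow, norm_inv, Complex.norm_natCast] at h2
      have h3 : x - y = (‖S t‖ - m.factorial * (‖z‖⁻¹) ^ (m + 1)) / m.factorial := by
        rw [hx, hy]; field_simp
      rw [h3, abs_div, abs_of_pos hf, div_le_iff₀ hf]
      linarith
    have hy0 : 0 ≤ y := by positivity
    have hyL : y * Real.log 2 ^ m ≤ (Real.log 2)⁻¹ := by
      have : y ≤ ((Real.log 2)⁻¹) ^ (m + 1) := pow_le_pow_left₀ (by positivity) (inv_anti₀ hL hz) _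
      refine (mul_le_mul_of_nonneg_right this (by positivity)).trans_eq ?_
      rw [pow_succ, inv_pow]
      field_simp
    have e : Real.log 2 ^ (2 * m) / (m.factorial : ℝ) ^ 2 * ‖S t‖ ^ 2 -
        (Real.log 2 ^ 2)⁻¹ * poleRatio t ^ (m + 1) =
        Real.log 2 ^ m * (Real.log 2 ^ m * (x ^ 2 - y ^ 2)) := by
      rw [poleRatio, Set.indicator_of_mem ht, hx, hy, ← hzdef]
      field_simp
      ring
    have hxy2 : |x ^ 2 - y ^ 2| ≤ M ^ 2 + 2 * M * y := by
      have : x ^ 2 - y ^ 2 = (x - y) * (x - y) + 2 * (x - y) * y := by ring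
      rw [this]
      refine (abs_add_le _ _).trans ?_
      rw [abs_mul, abs_mul, abs_mul, abs_of_nonneg hy0, abs_two]
      have := abs_nonneg (x - y)
      gcongr
      nlinarith
    have hLm1 : Real.log 2 ^ m ≤ 1 := pow_le_one₀ hL.le hL1
    have hLm0 : 0 < Real.log 2 ^ m := by positivity
    rw [e, Real.norm_eq_abs, abs_mul, abs_mul, abs_of_pos hLm0, mul_comm (_ + _)]
    refine mul_le_mul_of_nonneg_left ?_ hLm0.le
    calc Real.log 2 ^ m * |x ^ 2 - y ^ 2| ≤ Real.log 2 ^ m * (M ^ 2 + 2 * M * y) := by gcongr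
      _ = Real.log 2 ^ m * M ^ 2 + 2 * M * (y * Real.log 2 ^ m) := by ring
      _ ≤ 1 * M ^ 2 + 2 * M * (Real.log 2)⁻¹ := by gcongr
      _ = _ := by ring
  rw [hcount, hratio, ← mul_sub, ← MeasureTheory.integral_sub, abs_mul,
    abs_of_pos (by positivity), ← Real.norm_eq_abs]
  · have hvol : MeasureTheory.volume.real I = Real.pi := by
      rw [hI, Real.volume_real_Ioo_of_le (by linarith [Real.pi_pos])]
      ring
    have := MeasureTheory.norm_setIntegral_le_of_norm_le_const (μ := MeasureTheory.volume)
      (s := I) (by simp [hI]) hpoint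
    rw [hvol] at this
    refine (mul_le_mul_of_nonneg_left this (by positivity)).trans_eq ?_
    field_simp
  · refine (Continuous.integrableOn_Icc ?_).mono_set Set.Ioo_subset_Icc_self
    fun_prop
  · exact ((integrable_poleRatio_pow m).const_mul _).integrableOn

theorem exists_log_two_pow_le : ∃ C : ℝ, 0 ≤ C ∧ ∀ m : ℕ, 0 < m →
    Real.log 2 ^ m ≤ C / (m * √m) := by
  have hL : 0 < Real.log 2 := Real.log_pos one_lt_two
  have hL1 : Real.log 2 < 1 := by linarith [Real.log_two_lt_d9]
  obtain ⟨C, hC⟩ := (tendsto_pow_const_mul_const_pow_of_abs_lt_one 2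
    (by rwa [abs_of_pos hL])).bddAbove_range
  have hC' (m : ℕ) : (m : ℝ) ^ 2 * Real.log 2 ^ m ≤ C := hC ⟨m, rfl⟩
  refine ⟨C, by simpa using hC' 0, fun m hm => ?_⟩
  have hm' : (1 : ℝ) ≤ m := by exact_mod_cast hm
  have hs : √(m : ℝ) ≤ m := Real.sqrt_le_iff.mpr ⟨by linarith, by nlinarith⟩
  rw [le_div_iff₀ (by positivity)]
  refine le_trans ?_ (hC' m)
  rw [mul_comm, sq]
  gcongr

/-- `4 ^ m · (m!)² / (2m)!`, the reciprocal of the normalised central binomial coefficient. -/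
noncomputable def wallisRatio (m : ℕ) : ℝ :=
  4 ^ m * (m.factorial : ℝ) ^ 2 / ((2 * m).factorial : ℝ)

theorem wallisRatio_sq (m : ℕ) : wallisRatio m ^ 2 = Real.Wallis.W m * (2 * m + 1) := by
  rw [Real.Wallis.W_eq_factorial_ratio, wallisRatio, pow_mul, show (2 : ℝ) ^ 4 = 4 ^ 2 by norm_num,
    ← pow_mul, mul_comm 2 m, pow_mul]
  have : ((m * 2).factorial : ℝ) ≠ 0 := by exact_mod_cast Nat.factorial_ne_zero _
  field_simp

theorem wallisRatio_bounds (m : ℕ) :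
    wallisRatio m ≤ √(Real.pi * (m + 1)) ∧
      (1 - (2 * m + 2 : ℝ)⁻¹) * √(Real.pi * (m + 1)) ≤ wallisRatio m := by
  have h0 : 0 ≤ wallisRatio m := by rw [wallisRatio]; positivity
  have hsq := wallisRatio_sq m
  have hpi := Real.pi_pos
  have hm : (0 : ℝ) ≤ m := Nat.cast_nonneg m
  constructor
  · refine Real.le_sqrt_of_sq_le ?_
    rw [hsq]
    nlinarith [mul_le_mul_of_nonneg_right (Real.Wallis.W_le m)
      (by positivity : (0 : ℝ) ≤ 2 * m + 1)]
  · refine le_of_sq_le_sq ?_ h0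
    rw [mul_pow, Real.sq_sqrt (by positivity), hsq]
    refine le_trans (le_of_eq ?_) (mul_le_mul_of_nonneg_right (Real.Wallis.le_W m)
      (by positivity : (0 : ℝ) ≤ 2 * m + 1))
    field_simp
    ring

theorem exists_abs_excWordCount_sub_le : ∃ C : ℝ, 0 ≤ C ∧ ∀ p : ℕ,
    |(excWordCount (2 * p + 2) p : ℝ) * Real.log 2 ^ (2 * (p + 1)) / ((p + 1).factorial : ℝ) ^ 2 -
      1 / (2 * Real.log 2 * √(1 - Real.log 2)) / √(Real.pi * ((p + 1 : ℕ) + 1))| ≤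
        C / ((p + 1 : ℕ) * √(p + 1 : ℕ)) := by
  obtain ⟨C₁, hC₁, h₁⟩ := exists_abs_integral_poleRatio_pow_sub_le
  obtain ⟨C₂, hC₂, h₂⟩ := exists_abs_excWordCount_sub_integral_le
  obtain ⟨C₃, hC₃, h₃⟩ := exists_log_two_pow_le
  have hL : 0 < Real.log 2 := Real.log_pos one_lt_two
  have hL1 : 0 < 1 - Real.log 2 := by linarith [Real.log_two_lt_d9]
  have hpi := Real.pi_pos
  refine ⟨C₂ * C₃ + (2 * Real.pi * Real.log 2 ^ 2)⁻¹ * C₁, by positivity, fun p => ?_⟩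
  have h1 := h₁ (p + 1) p.succ_pos
  have h3 := h₃ (p + 1) p.succ_pos
  have hmain : (2 * Real.pi * Real.log 2 ^ 2)⁻¹ *
      √(Real.pi / (((p + 1 : ℕ) + 1) * poleCurvature)) =
      1 / (2 * Real.log 2 * √(1 - Real.log 2)) / √(Real.pi * ((p + 1 : ℕ) + 1)) := by
    have hN : (0 : ℝ) < (p + 1 : ℕ) + 1 := by positivity
    set N : ℝ := (p + 1 : ℕ) + 1
    have e : Real.pi / (N * poleCurvature) =
        (Real.pi * Real.log 2) ^ 2 / ((1 - Real.log 2) * (Real.pi * N)) := by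
      rw [poleCurvature]; field_simp
    rw [e, Real.sqrt_div (by positivity), Real.sqrt_sq (by positivity), Real.sqrt_mul hL1.le]
    field_simp
  rw [← hmain]
  have h2 : |(2 * Real.pi * Real.log 2 ^ 2)⁻¹ * (∫ t, poleRatio t ^ (p + 2)) -
      (2 * Real.pi * Real.log 2 ^ 2)⁻¹ * √(Real.pi / (((p + 1 : ℕ) + 1) * poleCurvature))| ≤
        (2 * Real.pi * Real.log 2 ^ 2)⁻¹ * (C₁ / ((p + 1 : ℕ) * √(p + 1 : ℕ))) := by
    rw [← mul_sub, abs_mul, abs_of_pos (by positivity)]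
    exact mul_le_mul_of_nonneg_left h1 (by positivity)
  refine (abs_sub_le _ _ _).trans ((add_le_add
    ((h₂ p).trans (mul_le_mul_of_nonneg_left h3 hC₂)) h2).trans_eq ?_)
  ring

theorem stmt18 :
    ∃ C : ℝ, 0 < C ∧
      ∀ n : ℕ, 0 < n → Even n →
        |(excWordCount n (n / 2 - 1) : ℝ) * (2 * Real.log 2) ^ n / (Nat.factorial n : ℝ) -
            1 / (2 * Real.log 2 * Real.sqrt (1 - Real.log 2))| ≤ C / Real.sqrt (n : ℝ) := by
  obtain ⟨C, hC, h⟩ := exists_abs_excWordCount_sub_le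
  have hL : 0 < Real.log 2 := Real.log_pos one_lt_two
  have hL1 : 0 < 1 - Real.log 2 := by linarith [Real.log_two_lt_d9]
  set τ : ℝ := 1 / (2 * Real.log 2 * √(1 - Real.log 2)) with hτ
  have hτ0 : 0 < τ := by positivity
  refine ⟨2 * (3 * C + τ), by positivity, fun n hn heven => ?_⟩
  obtain ⟨m, rfl⟩ := heven
  obtain ⟨p, rfl⟩ : ∃ p, m = p + 1 := ⟨m - 1, by omega⟩
  have hp := h p
  rw [show p + 1 + (p + 1) = 2 * (p + 1) by ring]
  rw [show 2 * (p + 1) / 2 - 1 = p by omega]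
  rw [show 2 * p + 2 = 2 * (p + 1) by ring] at hp
  obtain ⟨hw1, hw2⟩ := wallisRatio_bounds (p + 1)
  have hm1 : (1 : ℝ) ≤ (p + 1 : ℕ) := by exact_mod_cast p.succ_pos
  have hX : (excWordCount (2 * (p + 1)) p : ℝ) * (2 * Real.log 2) ^ (2 * (p + 1)) /
      ((2 * (p + 1)).factorial : ℝ) = wallisRatio (p + 1) * ((excWordCount (2 * (p + 1)) p : ℝ) *
        Real.log 2 ^ (2 * (p + 1)) / ((p + 1).factorial : ℝ) ^ 2) := by
    have hf : ((p + 1).factorial : ℝ) ≠ 0 := by exact_mod_cast Nat.factorial_ne_zero _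
    rw [wallisRatio, mul_pow, pow_mul 2 2, show (2 : ℝ) ^ 2 = 4 by norm_num]
    field_simp
  rw [hX]
  set H := (excWordCount (2 * (p + 1)) p : ℝ) * Real.log 2 ^ (2 * (p + 1)) /
    ((p + 1).factorial : ℝ) ^ 2
  rw [Nat.cast_mul, Nat.cast_two]
  set m : ℝ := ((p + 1 : ℕ) : ℝ)
  set w := wallisRatio (p + 1)
  set s := √(Real.pi * (m + 1)) with hs
  have hpi := Real.pi_pos
  have hs0 : 0 < s := by positivity
  have hm0 : 0 < √m := by positivity
  have hw0 : 0 ≤ w := by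
    refine le_trans (mul_nonneg ?_ hs0.le) hw2
    rw [sub_nonneg]
    exact inv_le_one_of_one_le₀ (by linarith)
  have hs3 : s ≤ 3 * √m := by
    rw [hs, show 3 * √m = √(9 * m) by
      rw [Real.sqrt_mul (by norm_num), show (9 : ℝ) = 3 ^ 2 by norm_num,
        Real.sqrt_sq (by norm_num)]]
    refine Real.sqrt_le_sqrt ?_
    nlinarith [Real.pi_lt_d2]
  have hsm : √m ≤ m := Real.sqrt_le_iff.mpr ⟨by linarith, by nlinarith⟩
  have hfirst : |w * (H - τ / s)| ≤ 3 * C / √m := by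
    rw [abs_mul, abs_of_nonneg hw0]
    calc w * |H - τ / s| ≤ 3 * √m * (C / (m * √m)) := by
          gcongr
          exact hw1.trans hs3
      _ = 3 * C / m := by field_simp
      _ ≤ 3 * C / √m := by gcongr
  have hsecond : |τ * (w / s - 1)| ≤ τ / √m := by
    rw [abs_mul, abs_of_pos hτ0, div_eq_mul_inv τ]
    refine mul_le_mul_of_nonneg_left ?_ hτ0.le
    have h1 : w / s ≤ 1 := (div_le_one hs0).mpr hw1
    have h2 : 1 - (2 * m + 2)⁻¹ ≤ w / s := (le_div_iff₀ hs0).mpr hw2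
    have h3 : (2 * m + 2)⁻¹ ≤ (√m)⁻¹ := inv_anti₀ hm0 (by linarith)
    rw [abs_le]
    constructor <;> linarith [inv_pos.mpr hm0]
  have hsplit : w * H - τ = w * (H - τ / s) + τ * (w / s - 1) := by
    field_simp
    ring
  have hn2 : √(2 * m) ≤ 2 * √m := by
    rw [Real.sqrt_le_left (by positivity), mul_pow, Real.sq_sqrt (by linarith)]
    linarith
  rw [hsplit]
  calc _ ≤ 3 * C / √m + τ / √m := (abs_add_le _ _).trans (add_le_add hfirst hsecond)
    _ = 2 * (3 * C + τ) / (2 * √m) := by field_simp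
    _ ≤ _ := by gcongr
end
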